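/- arXiv:1612.03782 — 3 statements merged into one kernel-verified Lean document; each statement's English description precedes it below -/
import Mathlib

section
/- Every *-functor a : A ⥤ B between small *-categories factors as a trivial cofibration followed by a fibration: there exist a small *-category P, a *-functor j : A ⥤ P that is injective on objects and a unitary equivalence, and a *-functor p : P ⥤ B that is good, such that j ⋙ p = a (equality of functors). -/
open CategoryTheory

universe v u

/-- A `*`-category: a category with an involution fixing objects. -/
class StarCategoryStruct (C : Type u) [Category.{v} C] : Type (max u v) where
  star : ∀ {X Y : C}, (X ⟶ Y) → (Y ⟶ X)
  star_star : ∀ {X Y : C} (f : X ⟶ Y), star (star f) = f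
  star_id : ∀ X : C, star (𝟙 X) = 𝟙 X
  star_comp : ∀ {X Y Z : C} (f : X ⟶ Y) (g : Y ⟶ Z), star (f ≫ g) = star g ≫ star f

/-- A morphism is unitary if its star is a two-sided inverse. -/
def IsUnitary {C : Type*} [Category C] [StarCategoryStruct C] {X Y : C} (u : X ⟶ Y) : Prop :=
  u ≫ StarCategoryStruct.star u = 𝟙 X ∧ StarCategoryStruct.star u ≫ u = 𝟙 Y

/-- A functor between `*`-categories is a `*`-functor if it preserves the involution. -/
def IsStarFunctor {C D : Type*} [Category C] [Category D]
    [StarCategoryStruct C] [StarCategoryStruct D] (F : C ⥤ D) : Prop :=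
  ∀ {X Y : C} (f : X ⟶ Y),
    F.map (StarCategoryStruct.star f) = StarCategoryStruct.star (F.map f)

/-- A `*`-functor is a unitary equivalence if it admits a `*`-functor inverse up to unitary
natural isomorphisms. -/
def IsUnitaryEquivalence {C D : Type*} [Category C] [Category D]
    [StarCategoryStruct C] [StarCategoryStruct D] (F : C ⥤ D) : Prop :=
  ∃ G : D ⥤ C, IsStarFunctor G ∧
    ∃ (η : F ⋙ G ≅ 𝟭 C) (ε : G ⋙ F ≅ 𝟭 D),
      (∀ X : C, IsUnitary (η.hom.app X)) ∧ (∀ Y : D, IsUnitary (ε.hom.app Y))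

/-- A `*`-functor is good (a unitary isofibration) if unitary morphisms out of an image object
lift along it. -/
def IsGood {C D : Type*} [Category C] [Category D]
    [StarCategoryStruct C] [StarCategoryStruct D] (F : C ⥤ D) : Prop :=
  ∀ (c : C) (d : D) (u : F.obj c ⟶ d), IsUnitary u →
    ∃ (c' : C) (h : F.obj c' = d) (v : c ⟶ c'),
      IsUnitary v ∧ F.map v ≫ eqToHom h = u
/-- A bundled small `*`-category. -/
structure StarCat : Type (u + 1) where
  carrier : Type u
  [cat : SmallCategory carrier]
  [str : StarCategoryStruct carrier]

attribute [instance] StarCat.cat StarCat.str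

instance : CoeSort StarCat.{u} (Type u) :=
  ⟨StarCat.carrier⟩

theorem isStarFunctor_id {C : Type*} [Category C] [StarCategoryStruct C] :
    IsStarFunctor (𝟭 C) := fun _ => rfl

theorem IsStarFunctor.comp {C D E : Type*} [Category C] [Category D] [Category E]
    [StarCategoryStruct C] [StarCategoryStruct D] [StarCategoryStruct E]
    {F : C ⥤ D} {G : D ⥤ E} (hF : IsStarFunctor F) (hG : IsStarFunctor G) :
    IsStarFunctor (F ⋙ G) := by
  intro X Y f
  show G.map (F.map _) = _
  rw [hF f, hG]
  rfl

/-- The category of small `*`-categories and `*`-functors. -/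
instance : Category StarCat.{u} where
  Hom A B := { F : A.carrier ⥤ B.carrier // IsStarFunctor F }
  id A := ⟨𝟭 A.carrier, isStarFunctor_id⟩
  comp F G := ⟨F.1 ⋙ G.1, IsStarFunctor.comp F.2 G.2⟩
  id_comp F := Subtype.ext (Functor.id_comp F.1)
  comp_id F := Subtype.ext (Functor.comp_id F.1)
  assoc F G H := Subtype.ext (Functor.assoc F.1 G.1 H.1)

section

open StarCategoryStruct

theorem isUnitary_id {C : Type*} [Category C] [StarCategoryStruct C] (X : C) :
    IsUnitary (𝟙 X) := by
  simp [IsUnitary, star_id]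

theorem IsUnitary.comp {C : Type*} [Category C] [StarCategoryStruct C] {X Y Z : C}
    {f : X ⟶ Y} {g : Y ⟶ Z} (hf : IsUnitary f) (hg : IsUnitary g) : IsUnitary (f ≫ g) := by
  constructor
  · rw [star_comp, Category.assoc, ← Category.assoc g, hg.1, Category.id_comp, hf.1]
  · rw [star_comp, Category.assoc, ← Category.assoc _ f, hf.2, Category.id_comp, hg.2]

/-- The full subcategory induced by a map on objects inherits the involution. -/
instance InducedCategory.starCategoryStruct {C D : Type*} [Category D] [StarCategoryStruct D]
    (F : C → D) : StarCategoryStruct (InducedCategory D F) where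
  star f := InducedCategory.homMk (star f.hom)
  star_star f := by ext; exact star_star f.hom
  star_id X := by ext; exact star_id (F X)
  star_comp f g := by ext; exact star_comp f.hom g.hom

/-- An object `source` of `A` together with a unitary morphism from its image under `a`. -/
structure UnitaryUnder {A B : Type*} [Category A] [Category B] [StarCategoryStruct B]
    (a : A ⥤ B) where
  /-- The object of `A`. -/
  source : A
  /-- The target of the unitary morphism. -/
  target : B
  /-- The unitary morphism. -/
  hom : a.obj source ⟶ target
  isUnitary : IsUnitary hom

/-- The mapping path `*`-category of `a`: morphisms are those between the underlying objects
of `A`. -/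
abbrev MappingPath {A B : Type*} [Category A] [Category B] [StarCategoryStruct B]
    (a : A ⥤ B) :=
  InducedCategory A (UnitaryUnder.source (a := a))

namespace MappingPath

variable {A B : Type*} [Category A] [Category B] [StarCategoryStruct B] (a : A ⥤ B)

/-- The object of the mapping path category given by an identity morphism. -/
def ofObj (x : A) : MappingPath a where
  source := x
  target := a.obj x
  hom := 𝟙 _
  isUnitary := isUnitary_id _

/-- The inclusion of `A` into the mapping path category. -/
def inclusion : A ⥤ MappingPath a where
  obj := ofObj a
  map f := InducedCategory.homMk f

/-- The projection of the mapping path category onto the targets of the unitary morphisms. -/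
def projection : MappingPath a ⥤ B where
  obj X := X.target
  map {X Y} f := star X.hom ≫ a.map f.hom ≫ Y.hom
  map_id X := by
    rw [InducedCategory.id_hom, a.map_id, Category.id_comp, X.isUnitary.2]
  map_comp {X Y Z} f g := by
    simp only [InducedCategory.comp_hom, a.map_comp, Category.assoc]
    rw [← Category.assoc Y.hom, Y.isUnitary.1, Category.id_comp]

theorem inclusion_obj_injective : Function.Injective (inclusion a).obj :=
  fun _ _ h => congrArg UnitaryUnder.source h

theorem inclusion_comp_projection : inclusion a ⋙ projection a = a := by
  refine CategoryTheory.Functor.ext (fun _ => rfl) fun X Y f => ?_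
  change star (𝟙 (a.obj X)) ≫ a.map f ≫ 𝟙 (a.obj Y) =
    𝟙 (a.obj X) ≫ a.map f ≫ 𝟙 (a.obj Y)
  rw [star_id]

variable [StarCategoryStruct A]

theorem isStarFunctor_inclusion : IsStarFunctor (inclusion a) := fun _ => rfl

theorem isUnitaryEquivalence_inclusion : IsUnitaryEquivalence (inclusion a) := by
  refine ⟨inducedFunctor _, fun _ => rfl, Iso.refl _,
    NatIso.ofComponents (fun X => InducedCategory.isoMk (Iso.refl X.source)) ?_, ?_, ?_⟩
  · intro X Y f
    ext
    exact (Category.comp_id f.hom).trans (Category.id_comp f.hom).symm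
  · exact fun X => isUnitary_id X
  · exact fun X => ⟨InducedCategory.hom_ext (isUnitary_id X.source).1,
      InducedCategory.hom_ext (isUnitary_id X.source).2⟩

variable {a}

theorem isStarFunctor_projection (ha : IsStarFunctor a) : IsStarFunctor (projection a) := by
  intro X Y f
  change star Y.hom ≫ a.map (star f.hom) ≫ X.hom = star (star X.hom ≫ a.map f.hom ≫ Y.hom)
  rw [star_comp, star_comp, StarCategoryStruct.star_star, ha, Category.assoc]

variable (a)

theorem isGood_projection : IsGood (projection a) := by
  intro X d (u : X.target ⟶ d) hu
  refine ⟨⟨X.source, d, X.hom ≫ u, X.isUnitary.comp hu⟩, rfl,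
    InducedCategory.homMk (𝟙 X.source), ?_, ?_⟩
  · exact ⟨InducedCategory.hom_ext (isUnitary_id X.source).1,
      InducedCategory.hom_ext (isUnitary_id X.source).2⟩
  · change (star X.hom ≫ a.map (𝟙 X.source) ≫ X.hom ≫ u) ≫ 𝟙 d = u
    rw [Category.comp_id, a.map_id, Category.id_comp, ← Category.assoc, X.isUnitary.2]
    exact Category.id_comp u

end MappingPath


end

/-- Every `*`-functor between small `*`-categories factors as a trivial cofibration (injective
on objects and a unitary equivalence) followed by a fibration (a good `*`-functor). -/
theorem factorization_trivialCofibration_fibration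
    {A B : Type u} [SmallCategory A] [SmallCategory B]
    [StarCategoryStruct A] [StarCategoryStruct B]
    (a : A ⥤ B) (ha : IsStarFunctor a) :
    ∃ (P : StarCat.{u}) (j : A ⥤ P.carrier) (p : P.carrier ⥤ B),
      IsStarFunctor j ∧ Function.Injective j.obj ∧ IsUnitaryEquivalence j ∧
      IsStarFunctor p ∧ IsGood p ∧
      j ⋙ p = a := by
  exact ⟨⟨MappingPath a⟩, MappingPath.inclusion a, MappingPath.projection a,
    MappingPath.isStarFunctor_inclusion a, MappingPath.inclusion_obj_injective a,
    MappingPath.isUnitaryEquivalence_inclusion a, MappingPath.isStarFunctor_projection ha,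
    MappingPath.isGood_projection a, MappingPath.inclusion_comp_projection a⟩
end

section
/- Characterization of unitary equivalences: let C and D be *-categories and F : C ⥤ D a *-functor. Then F is a unitary equivalence if and only if the following three conditions hold: (1) F is an equivalence of the underlying categories; (2) for every object d of D there exist an object c of C and a unitary morphism u : F.obj c ⟶ d; (3) for all objects c, c' of C, every unitary morphism w : F.obj c ⟶ F.obj c' is of the form F.map v for some unitary morphism v : c ⟶ c'. (Conditions (2) and (3), together with faithfulness of F, say that the induced functor on the wide subcategories of unitary morphisms is an equivalence.) -/
open CategoryTheory

universe v u

section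

open StarCategoryStruct

variable {C D : Type*} [Category C] [Category D]
  [StarCategoryStruct C] [StarCategoryStruct D]

/-- A unitary morphism, as an isomorphism whose inverse is its star. -/
def IsUnitary.toIso {X Y : C} {u : X ⟶ Y} (hu : IsUnitary u) : X ≅ Y where
  hom := u
  inv := star u
  hom_inv_id := hu.1
  inv_hom_id := hu.2

/-- A faithful `*`-functor reflects unitary morphisms. -/
theorem IsStarFunctor.isUnitary_of_map {F : C ⥤ D} (hF : IsStarFunctor F) [F.Faithful]
    {X Y : C} {f : X ⟶ Y} (hf : IsUnitary (F.map f)) : IsUnitary f :=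
  ⟨F.map_injective (by rw [F.map_comp, hF, hf.1, F.map_id]),
    F.map_injective (by rw [F.map_comp, hF, hf.2, F.map_id])⟩

theorem IsUnitaryEquivalence.isEquivalence {F : C ⥤ D} (h : IsUnitaryEquivalence F) :
    F.IsEquivalence := by
  obtain ⟨G, -, η, ε, -, -⟩ := h
  exact (CategoryTheory.Equivalence.mk F G η.symm ε).isEquivalence_functor

/-- The quasi-inverse of a fully faithful functor determined by a choice of preimages up to
isomorphism. -/
noncomputable def CategoryTheory.Functor.quasiInverse (F : C ⥤ D) [F.Full] [F.Faithful]
    (c : D → C) (e : ∀ d, F.obj (c d) ≅ d) : D ⥤ C where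
  obj := c
  map {d d'} f := F.preimage ((e d).hom ≫ f ≫ (e d').inv)
  map_id d := F.map_injective (by simp)
  map_comp f g := F.map_injective (by simp)

/-- The counit exhibiting `F.quasiInverse c e` as a right inverse of `F`. -/
noncomputable def CategoryTheory.Functor.quasiInverseCompIso (F : C ⥤ D) [F.Full] [F.Faithful]
    (c : D → C) (e : ∀ d, F.obj (c d) ≅ d) : F.quasiInverse c e ⋙ F ≅ 𝟭 D :=
  NatIso.ofComponents e fun {d d'} f => by
    change F.map (F.preimage ((e d).hom ≫ f ≫ (e d').inv)) ≫ (e d').hom = (e d).hom ≫ f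
    simp

/-- A right inverse, up to unitary natural isomorphism, of a faithful `*`-functor is a
`*`-functor. -/
theorem IsStarFunctor.of_comp_iso_id {F : C ⥤ D} (hF : IsStarFunctor F) [F.Faithful]
    {G : D ⥤ C} (ε : G ⋙ F ≅ 𝟭 D) (hε : ∀ Y, IsUnitary (ε.hom.app Y)) :
    IsStarFunctor G := by
  have map_map {X Y : D} (f : X ⟶ Y) :
      F.map (G.map f) = ε.hom.app X ≫ f ≫ star (ε.hom.app Y) := by
    have h := ε.hom.naturality f
    dsimp at h
    rw [← reassoc_of% h, (hε Y).1]
    exact (Category.comp_id _).symm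
  intro X Y f
  apply F.map_injective
  rw [hF, map_map, map_map, star_comp, star_comp, StarCategoryStruct.star_star, Category.assoc]

/-- A fully faithful `*`-functor that is surjective on objects up to unitary isomorphism is a
unitary equivalence. -/
theorem IsStarFunctor.isUnitaryEquivalence {F : C ⥤ D} (hF : IsStarFunctor F)
    [F.Full] [F.Faithful] (h : ∀ d : D, ∃ (c : C) (u : F.obj c ⟶ d), IsUnitary u) :
    IsUnitaryEquivalence F := by
  choose c u hu using h
  obtain ⟨G, ε, hε⟩ : ∃ (G : D ⥤ C) (ε : G ⋙ F ≅ 𝟭 D), ∀ Y, IsUnitary (ε.hom.app Y) :=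
    ⟨_, F.quasiInverseCompIso c fun d => (hu d).toIso, hu⟩
  refine ⟨G, hF.of_comp_iso_id ε hε,
    NatIso.ofComponents (fun X => F.preimageIso (ε.app (F.obj X))) fun {X Y} f => ?_,
    ε, fun X => hF.isUnitary_of_map ?_, hε⟩
  · apply F.map_injective
    simpa using ε.hom.naturality (F.map f)
  · simpa using hε (F.obj X)

end

/-- Characterization of unitary equivalences of `*`-categories. -/
theorem isUnitaryEquivalence_iff {C D : Type*} [Category C] [Category D]
    [StarCategoryStruct C] [StarCategoryStruct D]
    (F : C ⥤ D) (hF : IsStarFunctor F) :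
    IsUnitaryEquivalence F ↔
      (F.IsEquivalence ∧
       (∀ d : D, ∃ (c : C) (u : F.obj c ⟶ d), IsUnitary u) ∧
       (∀ (c c' : C) (w : F.obj c ⟶ F.obj c'), IsUnitary w →
          ∃ v : c ⟶ c', IsUnitary v ∧ F.map v = w)) := by
  constructor
  · intro h
    have := h.isEquivalence
    refine ⟨this, fun d => ?_, fun c c' w hw => ?_⟩
    · obtain ⟨G, -, -, ε, -, hε⟩ := h
      exact ⟨G.obj d, ε.hom.app d, hε d⟩
    · exact ⟨F.preimage w, hF.isUnitary_of_map (by rwa [F.map_preimage]), F.map_preimage w⟩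
  · rintro ⟨_, h, -⟩
    exact hF.isUnitaryEquivalence h
end

section
/- Computation of homotopy G-orbits (1-categorical core): let G be a group and let C and D be *-categories. Precomposition with 𝟭 C × q : C ♯ G̃ ⥤ C ♯ BG is a bijection from the set of *-functors C ♯ BG ⥤ D onto the set of *-functors Φ : C ♯ G̃ ⥤ D satisfying (𝟭 C × L_g) ⋙ Φ = Φ for all g ∈ G. (This identifies C ♯ BG as the colimit over BG of the G-object C ♯ G̃ with trivial action on C.) -/
open CategoryTheory

universe v u

theorem groupoid_inv_id {G : Type*} [Groupoid G] (x : G) :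
    Groupoid.inv (𝟙 x) = 𝟙 x := by
  simp [Groupoid.inv_eq_inv]

theorem groupoid_inv_comp' {G : Type*} [Groupoid G] {x y z : G} (f : x ⟶ y) (g : y ⟶ z) :
    Groupoid.inv (f ≫ g) = Groupoid.inv g ≫ Groupoid.inv f := by
  simp [Groupoid.inv_eq_inv]

theorem groupoid_inv_inv {G : Type*} [Groupoid G] {x y : G} (f : x ⟶ y) :
    Groupoid.inv (Groupoid.inv f) = f := by
  simp [Groupoid.inv_eq_inv]

/-- For a `*`-category `C` and a groupoid `G`, the product `C ♯ G` is a `*`-category with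
involution `(f, φ)* = (f*, φ⁻¹)`. -/
instance prodStarCategoryStruct (C : Type*) [Category C] [StarCategoryStruct C]
    (G : Type*) [Groupoid G] : StarCategoryStruct (C × G) where
  star f := (StarCategoryStruct.star f.1, Groupoid.inv f.2)
  star_star f := Prod.ext (StarCategoryStruct.star_star f.1) (groupoid_inv_inv f.2)
  star_id X := Prod.ext (StarCategoryStruct.star_id X.1) (groupoid_inv_id X.2)
  star_comp f g :=
    Prod.ext (StarCategoryStruct.star_comp f.1 g.1) (groupoid_inv_comp' f.2 g.2)

/-- The chaotic (indiscrete) groupoid on a type: exactly one morphism between any two objects. -/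
def Chaotic (G : Type u) : Type u := G

/-- Reinterpret an element as an object of the chaotic groupoid. -/
def Chaotic.mk {G : Type u} (g : G) : Chaotic G := g

/-- Reinterpret an object of the chaotic groupoid as an element. -/
def Chaotic.el {G : Type u} (g : Chaotic G) : G := g

instance {G : Type u} : Groupoid (Chaotic G) where
  Hom _ _ := PUnit
  id _ := PUnit.unit
  comp _ _ := PUnit.unit
  inv _ := PUnit.unit
  id_comp _ := rfl
  comp_id _ := rfl
  assoc _ _ _ := rfl
  inv_comp _ := rfl
  comp_inv _ := rfl

/-- The left-translation functor on the chaotic groupoid of a group. -/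
def leftTrans {G : Type u} [Group G] (g : G) : Chaotic G ⥤ Chaotic G where
  obj x := Chaotic.mk (g * x.el)
  map _ := PUnit.unit
  map_id _ := rfl
  map_comp _ _ := rfl

/-- The quotient functor from the chaotic groupoid of `G` onto the one-object groupoid `BG`,
sending the unique morphism `x ⟶ y` to `y⁻¹ * x`. -/
def qFunctor (G : Type u) [Group G] : Chaotic G ⥤ SingleObj G where
  obj _ := SingleObj.star G
  map {x y} _ := y.el⁻¹ * x.el
  map_id x := by
    show x.el⁻¹ * x.el = 𝟙 (SingleObj.star G)
    rw [SingleObj.id_as_one, inv_mul_cancel]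
  map_comp {x y z} _ _ := by
    show z.el⁻¹ * x.el = (z.el⁻¹ * y.el) * (y.el⁻¹ * x.el)
    group

theorem leftTrans_comp_qFunctor {G : Type u} [Group G] (g : G) :
    leftTrans g ⋙ qFunctor G = qFunctor G := by
  refine CategoryTheory.Functor.ext (fun x => rfl) ?_
  intro x y f
  show ((g * y.el)⁻¹ * (g * x.el) : G) =
    𝟙 (SingleObj.star G) ≫ (y.el⁻¹ * x.el) ≫ 𝟙 (SingleObj.star G)
  rw [Category.id_comp, Category.comp_id]
  group

theorem isStarFunctor_idProdQ {C : Type*} [Category C] [StarCategoryStruct C]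
    (G : Type u) [Group G] :
    IsStarFunctor ((𝟭 C).prod (qFunctor G)) := by
  intro X Y f
  apply Prod.ext
  · rfl
  · show ((X.2.el⁻¹ * Y.2.el : G)) = ((Y.2.el⁻¹ * X.2.el : G))⁻¹
    group

theorem idProd_leftTrans_comp_idProdQ {C : Type*} [Category C] [StarCategoryStruct C]
    {G : Type u} [Group G] (g : G) :
    (𝟭 C).prod (leftTrans g) ⋙ (𝟭 C).prod (qFunctor G) = (𝟭 C).prod (qFunctor G) := by
  refine CategoryTheory.Functor.ext (fun X => rfl) ?_
  intro X Y f
  simp only [eqToHom_refl, Category.id_comp, Category.comp_id]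
  apply Prod.ext
  · rfl
  · show ((g * Y.2.el)⁻¹ * (g * X.2.el) : G) = (Y.2.el⁻¹ * X.2.el : G)
    group

/-- The unique morphism between two objects of the chaotic groupoid. -/
def Chaotic.arrow {G : Type u} (x y : Chaotic G) : x ⟶ y := PUnit.unit

section

variable {C D : Type*} [Category C] [Category D] {G : Type u} [Group G]

theorem StarCategoryStruct.star_eqToHom [StarCategoryStruct D] {X Y : D} (h : X = Y) :
    StarCategoryStruct.star (eqToHom h) = eqToHom h.symm := by
  subst h
  exact StarCategoryStruct.star_id X

theorem obj_eq_of_invariant {Φ : (C × Chaotic G) ⥤ D}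
    (hΦ : ∀ g : G, (𝟭 C).prod (leftTrans g) ⋙ Φ = Φ) (c : C) (x y : Chaotic G) :
    Φ.obj (c, x) = Φ.obj (c, y) := by
  have h := Functor.congr_obj (hΦ (x.el * y.el⁻¹)) (c, y)
  rw [← h]
  show Φ.obj (c, x) = Φ.obj (c, Chaotic.mk (x.el * y.el⁻¹ * y.el))
  rw [inv_mul_cancel_right]
  rfl

theorem map_eq_of_invariant {Φ : (C × Chaotic G) ⥤ D}
    (hΦ : ∀ g : G, (𝟭 C).prod (leftTrans g) ⋙ Φ = Φ) {c d : C} (f : c ⟶ d)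
    {x y x' y' : Chaotic G} (h : y.el⁻¹ * x.el = y'.el⁻¹ * x'.el) :
    Φ.map (X := (c, x)) (Y := (d, y)) (f, Chaotic.arrow x y) =
      eqToHom (obj_eq_of_invariant hΦ c x x') ≫
        Φ.map (X := (c, x')) (Y := (d, y')) (f, Chaotic.arrow x' y') ≫
          eqToHom (obj_eq_of_invariant hΦ d y' y) := by
  obtain ⟨g, rfl, rfl⟩ : ∃ g : G, x' = Chaotic.mk (g * x.el) ∧ y' = Chaotic.mk (g * y.el) := by
    refine ⟨x'.el * x.el⁻¹, ?_, ?_⟩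
    · exact (inv_mul_cancel_right x'.el x.el).symm
    · show y'.el = x'.el * x.el⁻¹ * y.el
      rw [← inv_inj, ← mul_left_inj x'.el, ← h]
      group
  have key : Φ.map (X := (c, Chaotic.mk (g * x.el))) (Y := (d, Chaotic.mk (g * y.el)))
      (f, Chaotic.arrow _ _) = eqToHom (obj_eq_of_invariant hΦ c _ _) ≫
        Φ.map (X := (c, x)) (Y := (d, y)) (f, Chaotic.arrow x y) ≫
          eqToHom (obj_eq_of_invariant hΦ d _ _) :=
    Functor.congr_hom (hΦ g) (X := (c, x)) (Y := (d, y)) (f, Chaotic.arrow x y)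
  rw [key]
  simp

/-- The functor on `C × BG` induced by a `G`-invariant functor on `C × G̃`. -/
def descend (Φ : (C × Chaotic G) ⥤ D)
    (hΦ : ∀ g : G, (𝟭 C).prod (leftTrans g) ⋙ Φ = Φ) : (C × SingleObj G) ⥤ D where
  obj X := Φ.obj (X.1, Chaotic.mk 1)
  map {X Y} f := eqToHom (obj_eq_of_invariant hΦ X.1 _ _) ≫
    Φ.map (X := (X.1, Chaotic.mk (show G from f.2))) (Y := (Y.1, Chaotic.mk 1))
      (f.1, Chaotic.arrow _ _)
  map_id X := by
    have h : Φ.map (X := (X.1, Chaotic.mk (1 : G))) (Y := (X.1, Chaotic.mk 1))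
      (𝟙 X.1, Chaotic.arrow _ _) = 𝟙 _ := Φ.map_id _
    exact (Category.id_comp _).trans h
  map_comp {X Y Z} f g := by
    let a : G := f.2
    let b : G := g.2
    have h : Φ.map (X := (X.1, Chaotic.mk (b * a))) (Y := (Z.1, Chaotic.mk 1))
        (f.1 ≫ g.1, Chaotic.arrow _ _) =
        Φ.map (X := (X.1, Chaotic.mk (b * a))) (Y := (Y.1, Chaotic.mk b))
          (f.1, Chaotic.arrow _ _) ≫
        Φ.map (X := (Y.1, Chaotic.mk b)) (Y := (Z.1, Chaotic.mk 1))
          (g.1, Chaotic.arrow _ _) := by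
      rw [← Φ.map_comp]
      rfl
    have h' := map_eq_of_invariant hΦ f.1 (x := Chaotic.mk (b * a)) (y := Chaotic.mk b)
      (x' := Chaotic.mk a) (y' := Chaotic.mk 1) (by simp [Chaotic.mk, Chaotic.el])
    change eqToHom _ ≫ Φ.map (X := (X.1, Chaotic.mk (b * a))) (Y := (Z.1, Chaotic.mk 1))
        (f.1 ≫ g.1, Chaotic.arrow _ _) = _
    rw [h, h']
    simp [a, b]

theorem isStarFunctor_descend [StarCategoryStruct C] [StarCategoryStruct D]
    {Φ : (C × Chaotic G) ⥤ D} (hs : IsStarFunctor Φ)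
    (hΦ : ∀ g : G, (𝟭 C).prod (leftTrans g) ⋙ Φ = Φ) : IsStarFunctor (descend Φ hΦ) := by
  intro X Y f
  let a : G := f.2
  change eqToHom _ ≫ Φ.map (X := (Y.1, Chaotic.mk a⁻¹)) (Y := (X.1, Chaotic.mk 1))
      (StarCategoryStruct.star f.1, Chaotic.arrow _ _) =
    StarCategoryStruct.star (eqToHom _ ≫ Φ.map (X := (X.1, Chaotic.mk a))
      (Y := (Y.1, Chaotic.mk 1)) (f.1, Chaotic.arrow _ _))
  rw [StarCategoryStruct.star_comp, StarCategoryStruct.star_eqToHom, ← hs]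
  change _ = Φ.map (X := (Y.1, Chaotic.mk 1)) (Y := (X.1, Chaotic.mk a))
      (StarCategoryStruct.star f.1, Chaotic.arrow _ _) ≫ _
  rw [map_eq_of_invariant hΦ (StarCategoryStruct.star f.1) (x := Chaotic.mk 1)
    (y := Chaotic.mk a) (x' := Chaotic.mk a⁻¹) (y' := Chaotic.mk 1)
    (by simp [Chaotic.mk, Chaotic.el])]
  simp

theorem idProdQ_comp_descend (Φ : (C × Chaotic G) ⥤ D)
    (hΦ : ∀ g : G, (𝟭 C).prod (leftTrans g) ⋙ Φ = Φ) :
    (𝟭 C).prod (qFunctor G) ⋙ descend Φ hΦ = Φ := by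
  refine CategoryTheory.Functor.ext (fun X => obj_eq_of_invariant hΦ X.1 _ _) ?_
  intro X Y f
  change eqToHom (obj_eq_of_invariant hΦ X.1 (Chaotic.mk 1) (Chaotic.mk (Y.2.el⁻¹ * X.2.el))) ≫
    Φ.map (X := (X.1, Chaotic.mk (Y.2.el⁻¹ * X.2.el)))
    (Y := (Y.1, Chaotic.mk 1)) (f.1, Chaotic.arrow _ _) =
    eqToHom (obj_eq_of_invariant hΦ X.1 (Chaotic.mk 1) X.2) ≫
      Φ.map (X := (X.1, X.2)) (Y := (Y.1, Y.2)) (f.1, Chaotic.arrow _ _) ≫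
        eqToHom (obj_eq_of_invariant hΦ Y.1 Y.2 (Chaotic.mk 1))
  rw [map_eq_of_invariant hΦ f.1 (x := Chaotic.mk (Y.2.el⁻¹ * X.2.el)) (y := Chaotic.mk 1)
    (x' := X.2) (y' := Y.2) (by simp [Chaotic.mk, Chaotic.el])]
  simp

theorem idProdQ_comp_injective {F F' : (C × SingleObj G) ⥤ D}
    (h : (𝟭 C).prod (qFunctor G) ⋙ F = (𝟭 C).prod (qFunctor G) ⋙ F') : F = F' := by
  refine CategoryTheory.Functor.ext
    (fun X => Functor.congr_obj h (X.1, Chaotic.mk 1)) ?_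
  intro X Y f
  let a : G := f.2
  have key := Functor.congr_hom h (X := (X.1, Chaotic.mk a)) (Y := (Y.1, Chaotic.mk 1))
    (f.1, Chaotic.arrow _ _)
  have hf : ((𝟭 C).prod (qFunctor G)).map (X := (X.1, Chaotic.mk a))
      (Y := (Y.1, Chaotic.mk 1)) (f.1, Chaotic.arrow _ _) = f := by
    apply Prod.ext
    · rfl
    · show (1 : G)⁻¹ * a = a
      simp
  rw [Functor.comp_map, Functor.comp_map, hf] at key
  exact key

end

/-- Computation of homotopy `G`-orbits (1-categorical core): precomposition with
`𝟭 C × q : C ♯ G̃ ⥤ C ♯ BG` is a bijection from `*`-functors `C ♯ BG ⥤ D` onto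
`G`-invariant `*`-functors `C ♯ G̃ ⥤ D`. -/
theorem orbits_bijection {C D : Type*} [Category C] [Category D]
    [StarCategoryStruct C] [StarCategoryStruct D] (G : Type u) [Group G] :
    Function.Bijective (fun F : {F : (C × SingleObj G) ⥤ D // IsStarFunctor F} =>
      (⟨(𝟭 C).prod (qFunctor G) ⋙ F.1,
        IsStarFunctor.comp (isStarFunctor_idProdQ G) F.2,
        fun g => by rw [← Functor.assoc, idProd_leftTrans_comp_idProdQ]⟩ :
        {Φ : (C × Chaotic G) ⥤ D // IsStarFunctor Φ ∧
          ∀ g : G, (𝟭 C).prod (leftTrans g) ⋙ Φ = Φ})) := by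
  refine ⟨fun F F' h => Subtype.ext (idProdQ_comp_injective (Subtype.ext_iff.mp h)), fun Φ => ?_⟩
  exact ⟨⟨descend Φ.1 Φ.2.2, isStarFunctor_descend Φ.2.1 Φ.2.2⟩,
    Subtype.ext (idProdQ_comp_descend Φ.1 Φ.2.2)⟩
end
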